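/- Let P ⊆ ℝ² be a full-dimensional bipartite convex polytope with vertex partition V1, V2 and radii r1 ≤ r2, and suppose P has exactly 2k vertices (k ≥ 2). Let v ∈ V1 and let w1, w2 be the two vertices of P for which [v,w1] and [v,w2] are edges of P; likewise let v′ ∈ V2 with edges [v′,w1′], [v′,w2′]. Then the interior angles satisfy ∠(w1 − v, w2 − v) + ∠(w1′ − v′, w2′ − v′) = 2(1 − 1/k)π and ∠(w1′ − v′, w2′ − v′) ≤ (1 − 1/k)π ≤ ∠(w1 − v, w2 − v), where each of the two inequalities is an equality if and only if r1 = r2. -/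

import Mathlib

open Set Pointwise

noncomputable section

/-- Euclidean space `ℝ^d`. -/
abbrev Euc (d : ℕ) := EuclideanSpace ℝ (Fin d)

/-- A convex polytope: the convex hull of a finite set of points. -/
def IsPolytope {d : ℕ} (P : Set (Euc d)) : Prop :=
  ∃ S : Finset (Euc d), P = convexHull ℝ (S : Set (Euc d))

/-- `P` is full-dimensional: its affine span is all of `ℝ^d`. -/
def FullDim {d : ℕ} (P : Set (Euc d)) : Prop :=
  affineSpan ℝ P = ⊤

/-- `[v,w]` is an edge of `P`: an exposed face of `P` which is a segment with `v ≠ w`. -/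
def IsEdge {d : ℕ} (P : Set (Euc d)) (v w : Euc d) : Prop :=
  v ≠ w ∧ IsExposed ℝ P (segment ℝ v w)

/-- `e` is an edge of `P`, as a set. -/
def IsEdgeSet {d : ℕ} (P e : Set (Euc d)) : Prop :=
  ∃ v w : Euc d, IsEdge P v w ∧ e = segment ℝ v w

/-- `T` is a symmetry of `P`: a linear isometry mapping `P` onto itself. -/
def IsAut {d : ℕ} (P : Set (Euc d)) (T : Euc d ≃ₗᵢ[ℝ] Euc d) : Prop :=
  T '' P = P

/-- `P` is vertex-transitive: any vertex (extreme point) can be mapped onto any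
other by a symmetry of `P`. -/
def VertexTransitive {d : ℕ} (P : Set (Euc d)) : Prop :=
  ∀ v ∈ Set.extremePoints ℝ P, ∀ w ∈ Set.extremePoints ℝ P,
    ∃ T : Euc d ≃ₗᵢ[ℝ] Euc d, IsAut P T ∧ T v = w

/-- `P` is edge-transitive: any edge can be mapped onto any other by a symmetry of `P`. -/
def EdgeTransitive {d : ℕ} (P : Set (Euc d)) : Prop :=
  ∀ e e' : Set (Euc d), IsEdgeSet P e → IsEdgeSet P e' →
    ∃ T : Euc d ≃ₗᵢ[ℝ] Euc d, IsAut P T ∧ T '' e = e'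

/-- `P` is bipartite with vertex partition `V1, V2`, radii `r1 ≤ r2` and edge length `ℓ`:
all edges have length `ℓ`, every edge joins `V1` to `V2`, where `V1 ⊔ V2` is a partition of
the vertex set, and vertices in `Vᵢ` have norm `rᵢ`. -/
def IsBipartiteWith {d : ℕ} (P V1 V2 : Set (Euc d)) (r1 r2 ℓ : ℝ) : Prop :=
  (0 < ℓ) ∧ (∀ v w : Euc d, IsEdge P v w → ‖v - w‖ = ℓ) ∧
  (V1 ∪ V2 = Set.extremePoints ℝ P) ∧ Disjoint V1 V2 ∧
  (∀ v w : Euc d, IsEdge P v w → (v ∈ V1 ∧ w ∈ V2) ∨ (v ∈ V2 ∧ w ∈ V1)) ∧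
  (0 < r1) ∧ (r1 ≤ r2) ∧ (∀ v ∈ V1, ‖v‖ = r1) ∧ (∀ v ∈ V2, ‖v‖ = r2)

/-- `P` is a bipartite polytope. -/
def IsBipartite {d : ℕ} (P : Set (Euc d)) : Prop :=
  ∃ (V1 V2 : Set (Euc d)) (r1 r2 ℓ : ℝ), IsBipartiteWith P V1 V2 r1 r2 ℓ

/-- `P` is a strictly bipartite polytope (`r1 < r2`). -/
def IsStrictlyBipartite {d : ℕ} (P : Set (Euc d)) : Prop :=
  ∃ (V1 V2 : Set (Euc d)) (r1 r2 ℓ : ℝ), IsBipartiteWith P V1 V2 r1 r2 ℓ ∧ r1 < r2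

/-- The determinant of two plane vectors. -/
def planeDet (x y : Euc 2) : ℝ := x 0 * y 1 - x 1 * y 0

/-- The inner product of two plane vectors, in coordinates. -/
def planeDot (x y : Euc 2) : ℝ := x 0 * y 0 + x 1 * y 1

lemma planeDot_eq_inner (x y : Euc 2) : planeDot x y = inner ℝ x y := by
  simp [planeDot, PiLp.inner_apply, Fin.sum_univ_two, mul_comm]

lemma planeDot_self (x : Euc 2) : planeDot x x = ‖x‖ ^ 2 := by
  rw [planeDot_eq_inner, real_inner_self_eq_norm_sq]

lemma planeDot_sq_add_planeDet_sq (x y : Euc 2) :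
    planeDot x y ^ 2 + planeDet x y ^ 2 = ‖x‖ ^ 2 * ‖y‖ ^ 2 := by
  rw [← planeDot_self, ← planeDot_self]
  simp only [planeDot, planeDet]
  ring

lemma planeDot_eq_of_norm_sub (x y : Euc 2) :
    planeDot x y = (‖x‖ ^ 2 + ‖y‖ ^ 2 - ‖x - y‖ ^ 2) / 2 := by
  rw [← planeDot_self, ← planeDot_self, ← planeDot_self]
  simp only [planeDot, PiLp.sub_apply]
  ring

lemma planeDet_swap (x y : Euc 2) : planeDet y x = -planeDet x y := by
  simp only [planeDet]
  ring

lemma planeDet_sub_sub (x y z : Euc 2) :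
    planeDet (y - x) (z - x) = planeDet y z + planeDet x y - planeDet x z := by
  simp only [planeDet, PiLp.sub_apply]
  ring

lemma eq_of_planeDot_eq_of_planeDet_eq {x y z : Euc 2} (hx : x ≠ 0)
    (hdot : planeDot x y = planeDot x z) (hdet : planeDet x y = planeDet x z) : y = z := by
  have hpos : 0 < planeDot x x := by
    rw [planeDot_self]
    have := norm_pos_iff.2 hx
    positivity
  have e0 : planeDot x x * (y 0 - z 0) = 0 := by
    simp only [planeDot, planeDet] at *
    linear_combination x 0 * hdot - x 1 * hdet
  have e1 : planeDot x x * (y 1 - z 1) = 0 := by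
    simp only [planeDot, planeDet] at *
    linear_combination x 1 * hdot + x 0 * hdet
  ext i
  fin_cases i
  · simpa [hpos.ne', sub_eq_zero] using e0
  · simpa [hpos.ne', sub_eq_zero] using e1

lemma exists_eq_planeDot (f : Euc 2 →L[ℝ] ℝ) : ∃ g : Euc 2, ∀ z, f z = planeDot g z := by
  refine ⟨(InnerProductSpace.toDual ℝ (Euc 2)).symm f, fun z => ?_⟩
  rw [planeDot_eq_inner, InnerProductSpace.toDual_symm_apply]

lemma not_forall_planeDet_eq_zero {P : Set (Euc 2)} (hfull : FullDim P) {u : Euc 2}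
    (hu : u ≠ 0) (x : Euc 2) : ¬ ∀ z ∈ P, planeDet u (z - x) = 0 := by
  intro h
  let A : AffineSubspace ℝ (Euc 2) :=
    { carrier := {z | planeDet u (z - x) = 0}
      smul_vsub_vadd_mem' := by
        intro c p q r hp hq hr
        simp only [planeDet, Set.mem_ofPred_eq, vsub_eq_sub, vadd_eq_add, PiLp.sub_apply,
          PiLp.add_apply, PiLp.smul_apply, smul_eq_mul] at *
        linear_combination c * hp - c * hq + hr }
  have hA : (⊤ : AffineSubspace ℝ (Euc 2)) ≤ A := by
    rw [← hfull]
    exact affineSpan_le.2 h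
  have hmem : ∀ z, planeDet u (z - x) = 0 := fun z => hA (AffineSubspace.mem_top ℝ _ z)
  have h1 := hmem (x + !₂[-u 1, u 0])
  simp only [planeDet, add_sub_cancel_left] at h1
  simp at h1
  apply hu
  ext i
  fin_cases i <;> simp <;> nlinarith [sq_nonneg (u 0), sq_nonneg (u 1)]

lemma segment_planeDet {x y z : Euc 2} (hz : z ∈ segment ℝ x y) :
    planeDet (y - x) (z - x) = 0 := by
  obtain ⟨a, b, -, -, hab, rfl⟩ := hz
  have ha : a = 1 - b := by linarith
  subst ha
  simp only [planeDet, PiLp.sub_apply, PiLp.add_apply, PiLp.smul_apply, smul_eq_mul]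
  ring

/-- A segment on which a supporting linear functional is attained is an exposed face. -/
lemma isEdge_of_forall_planeDet {S : Set (Euc 2)} {x y : Euc 2} {ε : ℝ} (hxy : x ≠ y)
    (hx : x ∈ S) (hy : y ∈ S)
    (h : ∀ z ∈ S, 0 < ε * planeDet (y - x) (z - x) ∨ z ∈ segment ℝ x y) :
    IsEdge (convexHull ℝ S) x y ∧
      ∀ z ∈ convexHull ℝ S, 0 ≤ ε * planeDet (y - x) (z - x) := by
  have hC : Convex ℝ {z | 0 < ε * planeDet (y - x) (z - x) ∨ z ∈ segment ℝ x y} := by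
    rw [convex_iff_forall_pos]
    intro p hp q hq a b ha hb hab
    have key : ε * planeDet (y - x) (a • p + b • q - x)
        = a * (ε * planeDet (y - x) (p - x)) + b * (ε * planeDet (y - x) (q - x)) := by
      have ha : a = 1 - b := by linarith
      subst ha
      simp only [planeDet, PiLp.sub_apply, PiLp.add_apply, PiLp.smul_apply, smul_eq_mul]
      ring
    simp only [Set.mem_ofPred_eq] at hp hq ⊢
    rw [key]
    rcases hp with hp | hp <;> rcases hq with hq | hq
    · left; positivity
    · left; rw [segment_planeDet hq]; simp only [mul_zero, add_zero]; positivity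
    · left; rw [segment_planeDet hp]; simp only [mul_zero, zero_add]; positivity
    · exact Or.inr (convex_segment x y hp hq ha.le hb.le hab)
  have hsub := convexHull_min (s := S) h hC
  have hxP := subset_convexHull ℝ S hx
  have hyP := subset_convexHull ℝ S hy
  have hnonneg : ∀ z ∈ convexHull ℝ S, 0 ≤ ε * planeDet (y - x) (z - x) := by
    intro z hz
    rcases hsub hz with h1 | h1
    · exact h1.le
    · simp [segment_planeDet h1]
  refine ⟨⟨hxy, fun _ => ⟨innerSL ℝ !₂[ε * (y - x) 1, -(ε * (y - x) 0)], ?_⟩⟩, hnonneg⟩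
  have hl : ∀ p q : Euc 2, innerSL ℝ !₂[ε * (y - x) 1, -(ε * (y - x) 0)] p
      ≤ innerSL ℝ !₂[ε * (y - x) 1, -(ε * (y - x) 0)] q ↔
      ε * planeDet (y - x) (q - x) ≤ ε * planeDet (y - x) (p - x) := by
    intro p q
    rw [innerSL_apply_apply, innerSL_apply_apply, ← planeDot_eq_inner, ← planeDot_eq_inner]
    simp [planeDet, planeDot]
    constructor <;> intro h <;> nlinarith
  ext z
  simp only [Set.mem_ofPred_eq, hl]
  constructor
  · intro hz
    refine ⟨(convex_convexHull ℝ S).segment_subset hxP hyP hz, fun p hp => ?_⟩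
    rw [segment_planeDet hz, mul_zero]
    exact hnonneg p hp
  · rintro ⟨hz, hmax⟩
    have := hmax x hxP
    rcases hsub hz with h1 | h1
    · simp only [planeDet, sub_self, PiLp.zero_apply, mul_zero] at this h1
      linarith
    · exact h1

/-- A vertex of a plane polytope has a neighbour such that the polytope lies on a prescribed
side of the connecting edge. -/
lemma exists_isEdge_forall_planeDet {P : Set (Euc 2)} (hP : IsPolytope P) (hfull : FullDim P)
    {x : Euc 2} (hx : x ∈ Set.extremePoints ℝ P) {ε : ℝ} (hε : ε ≠ 0) :
    ∃ y, IsEdge P x y ∧ ∀ z ∈ P, 0 ≤ ε * planeDet (y - x) (z - x) := by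
  classical
  obtain ⟨S, rfl⟩ := hP
  have hxS : x ∈ S := extremePoints_convexHull_subset hx
  have hxT : x ∉ convexHull ℝ ((S.erase x : Finset (Euc 2)) : Set (Euc 2)) := by
    intro hmem
    have hconv := (((convex_convexHull ℝ (S : Set (Euc 2))).mem_extremePoints_iff_convex_sdiff).1
      hx).2
    have hsub : ((S.erase x : Finset (Euc 2)) : Set (Euc 2)) ⊆
        convexHull ℝ (S : Set (Euc 2)) \ {x} := by
      intro z hz
      rw [Finset.mem_coe, Finset.mem_erase] at hz
      exact ⟨subset_convexHull ℝ _ hz.2, hz.1⟩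
    exact (convexHull_min hsub hconv hmem).2 rfl
  obtain ⟨f, u, hfx, hf⟩ := geometric_hahn_banach_point_closed (convex_convexHull ℝ _)
    ((S.erase x).finite_toSet.isCompact_convexHull ℝ).isClosed hxT
  obtain ⟨g, hg⟩ := exists_eq_planeDot f
  have hpos : ∀ z ∈ S.erase x, 0 < planeDot g (z - x) := by
    intro z hz
    have := hf z (subset_convexHull ℝ _ hz)
    rw [← hg, map_sub]
    linarith
  have hne : (S.erase x).Nonempty := by
    by_contra hcon
    rw [Finset.not_nonempty_iff_eq_empty] at hcon
    have hS : (S : Set (Euc 2)) ⊆ {x} := by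
      intro z hz
      by_contra hzx
      have : z ∈ S.erase x := Finset.mem_erase.2 ⟨hzx, hz⟩
      simp [hcon] at this
    have hu : (!₂[1, 0] : Euc 2) ≠ 0 := by
      intro h0
      have := congrArg (fun z : Euc 2 => z 0) h0
      simp at this
    refine not_forall_planeDet_eq_zero hfull hu x fun z hz => ?_
    have := convexHull_min hS (convex_singleton x) hz
    rw [Set.mem_singleton_iff] at this
    simp [this, planeDet]
  let m : Euc 2 → ℝ := fun z => ε * planeDet g (z - x) / planeDot g (z - x)
  obtain ⟨y₀, hy₀, hmin⟩ := Finset.exists_min_image _ m hne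
  obtain ⟨y, hy, hmax⟩ := Finset.exists_max_image ((S.erase x).filter fun z => m z = m y₀)
    (fun z => planeDot g (z - x)) ⟨y₀, by simp [Finset.mem_filter, hy₀]⟩
  rw [Finset.mem_filter] at hy
  have hyx : x ≠ y := fun h => (Finset.mem_erase.1 hy.1).1 h.symm
  refine ⟨y, isEdge_of_forall_planeDet hyx hxS (Finset.mem_erase.1 hy.1).2 fun z hz => ?_⟩
  by_cases hzx : z = x
  · exact Or.inr (hzx ▸ left_mem_segment ℝ x y)
  have hzT : z ∈ S.erase x := Finset.mem_erase.2 ⟨hzx, hz⟩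
  have hfz := hpos z hzT
  have hfy := hpos y hy.1
  have hle : m y ≤ m z := hy.2 ▸ hmin z hzT
  have hgpos : 0 < planeDot g g := by
    rw [planeDot_self]
    have : g ≠ 0 := by
      rintro rfl
      simp [planeDot] at hfz
    have := norm_pos_iff.2 this
    positivity
  have hid : planeDot g g * planeDet (y - x) (z - x) = planeDot g (y - x) * planeDet g (z - x)
      - planeDet g (y - x) * planeDot g (z - x) := by
    simp only [planeDot, planeDet]
    ring
  rcases hle.lt_or_eq with hlt | heq
  · left
    rw [div_lt_div_iff₀ hfy hfz] at hlt
    have : 0 < planeDot g g * (ε * planeDet (y - x) (z - x)) := by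
      rw [mul_left_comm, hid]
      linarith
    exact pos_of_mul_pos_right this hgpos.le
  · right
    have hzmax := hmax z (Finset.mem_filter.2 ⟨hzT, heq ▸ hy.2⟩)
    rw [div_eq_div_iff hfy.ne' hfz.ne'] at heq
    have hdet : planeDet g (y - x) * planeDot g (z - x)
        = planeDet g (z - x) * planeDot g (y - x) := by
      apply mul_left_cancel₀ hε
      linarith
    have hg0 : g ≠ 0 := by
      rintro rfl
      simp [planeDot] at hgpos
    have hzy : z - x = (planeDot g (z - x) / planeDot g (y - x)) • (y - x) := by
      apply eq_of_planeDot_eq_of_planeDet_eq hg0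
      · have : ∀ c : ℝ, planeDot g (c • (y - x)) = c * planeDot g (y - x) := by
          intro c
          simp only [planeDot, PiLp.smul_apply, smul_eq_mul]
          ring
        rw [this]
        field_simp
      · have : ∀ c : ℝ, planeDet g (c • (y - x)) = c * planeDet g (y - x) := by
          intro c
          simp only [planeDet, PiLp.smul_apply, smul_eq_mul]
          ring
        rw [this]
        field_simp
        linarith
    rw [segment_eq_image']
    refine ⟨planeDot g (z - x) / planeDot g (y - x), ⟨by positivity, ?_⟩, ?_⟩
    · rwa [div_le_one hfy]
    · simp only [← hzy, add_sub_cancel]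

lemma IsEdge.symm {d : ℕ} {P : Set (Euc d)} {v w : Euc d} (h : IsEdge P v w) : IsEdge P w v :=
  ⟨h.1.symm, segment_symm ℝ v w ▸ h.2⟩

lemma IsEdge.left_mem {d : ℕ} {P : Set (Euc d)} {v w : Euc d} (h : IsEdge P v w) : v ∈ P :=
  h.2.subset (left_mem_segment ℝ v w)

lemma IsEdge.right_mem {d : ℕ} {P : Set (Euc d)} {v w : Euc d} (h : IsEdge P v w) : w ∈ P :=
  h.symm.left_mem

namespace IsBipartiteWith

lemma mem_V2_of_isEdge {d : ℕ} {P V1 V2 : Set (Euc d)} {r1 r2 ℓ : ℝ}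
    (h : IsBipartiteWith P V1 V2 r1 r2 ℓ) {v w : Euc d} (hv : v ∈ V1) (hvw : IsEdge P v w) :
    w ∈ V2 := by
  obtain ⟨-, -, -, hdis, hpart, -⟩ := h
  rcases hpart v w hvw with h1 | h1
  · exact h1.2
  · exact absurd h1.1 (Set.disjoint_left.1 hdis hv)

lemma mem_V1_of_isEdge {d : ℕ} {P V1 V2 : Set (Euc d)} {r1 r2 ℓ : ℝ}
    (h : IsBipartiteWith P V1 V2 r1 r2 ℓ) {v w : Euc d} (hv : v ∈ V2) (hvw : IsEdge P v w) :
    w ∈ V1 := by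
  obtain ⟨-, -, -, hdis, hpart, -⟩ := h
  rcases hpart v w hvw with h1 | h1
  · exact absurd hv (Set.disjoint_left.1 hdis h1.1)
  · exact h1.2

lemma norm_mul_norm {d : ℕ} {P V1 V2 : Set (Euc d)} {r1 r2 ℓ : ℝ}
    (h : IsBipartiteWith P V1 V2 r1 r2 ℓ) {v w : Euc d} (hvw : IsEdge P v w) :
    ‖v‖ * ‖w‖ = r1 * r2 := by
  obtain ⟨-, -, -, -, hpart, -, -, h1, h2⟩ := h
  rcases hpart v w hvw with ⟨hv, hw⟩ | ⟨hv, hw⟩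
  · rw [h1 v hv, h2 w hw]
  · rw [h2 v hv, h1 w hw, mul_comm]

lemma planeDot_eq {P V1 V2 : Set (Euc 2)} {r1 r2 ℓ : ℝ} (h : IsBipartiteWith P V1 V2 r1 r2 ℓ)
    {v w : Euc 2} (hvw : IsEdge P v w) : planeDot v w = (r1 ^ 2 + r2 ^ 2 - ℓ ^ 2) / 2 := by
  obtain ⟨-, hlen, -, -, hpart, -, -, h1, h2⟩ := h
  rw [planeDot_eq_of_norm_sub, hlen v w hvw]
  rcases hpart v w hvw with ⟨hv, hw⟩ | ⟨hv, hw⟩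
  · rw [h1 v hv, h2 w hw]
  · rw [h2 v hv, h1 w hw, add_comm (r2 ^ 2)]

lemma planeDot_sq_add_planeDet_sq {P V1 V2 : Set (Euc 2)} {r1 r2 ℓ : ℝ}
    (h : IsBipartiteWith P V1 V2 r1 r2 ℓ) {v w : Euc 2} (hvw : IsEdge P v w) :
    planeDot v w ^ 2 + planeDet v w ^ 2 = (r1 * r2) ^ 2 := by
  rw [_root_.planeDot_sq_add_planeDet_sq, ← mul_pow, h.norm_mul_norm hvw]

lemma ne_zero {P V1 V2 : Set (Euc 2)} {r1 r2 ℓ : ℝ} (h : IsBipartiteWith P V1 V2 r1 r2 ℓ)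
    {v : Euc 2} (hv : v ∈ Set.extremePoints ℝ P) : v ≠ 0 := by
  obtain ⟨-, -, hV, -, -, h0, hle, h1, h2⟩ := h
  rw [← hV] at hv
  rw [← norm_pos_iff]
  rcases hv with hv | hv
  · rw [h1 v hv]
    exact h0
  · rw [h2 v hv]
    exact h0.trans_le hle

lemma mem_extremePoints_of_isEdge {P V1 V2 : Set (Euc 2)} {r1 r2 ℓ : ℝ}
    (h : IsBipartiteWith P V1 V2 r1 r2 ℓ) {v w : Euc 2} (hvw : IsEdge P v w) :
    v ∈ Set.extremePoints ℝ P := by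
  obtain ⟨-, -, hV, -, hpart, -⟩ := h
  rw [← hV]
  rcases hpart v w hvw with h1 | h1
  · exact Or.inl h1.1
  · exact Or.inr h1.1

/-- Two edges at a common vertex lie symmetrically about the line through the origin. -/
lemma planeDet_eq_neg {P V1 V2 : Set (Euc 2)} {r1 r2 ℓ : ℝ}
    (h : IsBipartiteWith P V1 V2 r1 r2 ℓ) {v a b : Euc 2} (ha : IsEdge P v a)
    (hb : IsEdge P v b) (hab : a ≠ b) :
    planeDet v b = -planeDet v a ∧ planeDet v a ≠ 0 := by
  have hdot : planeDot v a = planeDot v b := by rw [h.planeDot_eq ha, h.planeDot_eq hb]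
  have hsq : planeDet v b ^ 2 = planeDet v a ^ 2 := by
    have h1 := h.planeDot_sq_add_planeDet_sq ha
    have h2 := h.planeDot_sq_add_planeDet_sq hb
    rw [hdot] at h1
    linarith
  have hne : planeDet v a ≠ planeDet v b := fun hdet => hab <|
    eq_of_planeDot_eq_of_planeDet_eq (h.ne_zero (h.mem_extremePoints_of_isEdge ha)) hdot hdet
  have hneg : planeDet v b = -planeDet v a :=
    (sq_eq_sq_iff_eq_or_eq_neg.1 hsq).resolve_left hne.symm
  refine ⟨hneg, fun h0 => hne ?_⟩
  rw [hneg, h0, neg_zero]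

/-- The position of the second neighbour relative to an edge, for a vertex `v`. -/
lemma norm_sq_mul_planeDet_sub {P V1 V2 : Set (Euc 2)} {r1 r2 ℓ : ℝ}
    (h : IsBipartiteWith P V1 V2 r1 r2 ℓ) {v a b : Euc 2} (ha : IsEdge P v a)
    (hb : IsEdge P v b) (hab : a ≠ b) :
    ‖v‖ ^ 2 * planeDet (a - v) (b - v) = 2 * planeDet v a * (‖v‖ ^ 2 - planeDot v a) := by
  have hdot : planeDot v a = planeDot v b := by rw [h.planeDot_eq ha, h.planeDot_eq hb]
  have hneg := (h.planeDet_eq_neg ha hb hab).1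
  have hid : planeDot v v * planeDet (a - v) (b - v) = planeDot v a * planeDet v b
      - planeDet v a * planeDot v b + planeDot v v * (planeDet v a - planeDet v b) := by
    simp only [planeDot, planeDet, PiLp.sub_apply]
    ring
  rw [← planeDot_self, hid, hneg, ← hdot]
  ring

lemma planeDot_lt_norm_sq {P V1 V2 : Set (Euc 2)} {r1 r2 ℓ : ℝ}
    (h : IsBipartiteWith P V1 V2 r1 r2 ℓ) {v a : Euc 2} (hv : v ∈ V2) (ha : IsEdge P v a)
    (hdet : planeDet v a ≠ 0) : planeDot v a < ‖v‖ ^ 2 := by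
  have hsq := h.planeDot_sq_add_planeDet_sq ha
  obtain ⟨-, -, -, -, -, h0, hle, -, h2⟩ := h
  rw [h2 v hv]
  have hpos : 0 < planeDet v a ^ 2 := by positivity
  have : r1 * r2 ≤ r2 ^ 2 := by nlinarith
  have hrr : 0 < r1 * r2 := mul_pos h0 (h0.trans_le hle)
  have : planeDot v a < r1 * r2 := by
    apply lt_of_pow_lt_pow_left₀ 2 hrr.le
    linarith
  linarith

lemma exists_neighbours_of_mem_V2 {P V1 V2 : Set (Euc 2)} {r1 r2 ℓ : ℝ} (hP : IsPolytope P)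
    (hfull : FullDim P) (h : IsBipartiteWith P V1 V2 r1 r2 ℓ) {w : Euc 2} (hw : w ∈ V2) :
    ∃ a b, IsEdge P w a ∧ (∀ z ∈ P, 0 ≤ planeDet (a - w) (z - w)) ∧ 0 < planeDet w a ∧
      IsEdge P w b ∧ (∀ z ∈ P, planeDet (b - w) (z - w) ≤ 0) ∧
      planeDet w b = -planeDet w a ∧ a ≠ b := by
  have hwE : w ∈ Set.extremePoints ℝ P := by
    rw [← h.2.2.1]
    exact Or.inr hw
  obtain ⟨a, ha, hal⟩ := exists_isEdge_forall_planeDet hP hfull hwE one_ne_zero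
  obtain ⟨b, hb, hbr⟩ := exists_isEdge_forall_planeDet hP hfull hwE
    (neg_ne_zero.2 one_ne_zero : (-1 : ℝ) ≠ 0)
  simp only [one_mul, neg_mul, Left.nonneg_neg_iff] at hal hbr
  have hab : a ≠ b := by
    rintro rfl
    exact not_forall_planeDet_eq_zero hfull (sub_ne_zero.2 ha.1.symm) w
      fun z hz => le_antisymm (hbr z hz) (hal z hz)
  obtain ⟨hneg, hne⟩ := h.planeDet_eq_neg ha hb hab
  refine ⟨a, b, ha, hal, ?_, hb, hbr, hneg, hab⟩
  have hnonneg : 0 ≤ 2 * planeDet w a * (‖w‖ ^ 2 - planeDot w a) := by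
    rw [← h.norm_sq_mul_planeDet_sub ha hb hab]
    exact mul_nonneg (by positivity) (hal b hb.right_mem)
  have hlt := sub_pos.2 (h.planeDot_lt_norm_sq hw ha hne)
  have := nonneg_of_mul_nonneg_left hnonneg hlt
  exact lt_of_le_of_ne (by linarith) hne.symm

/-- Every vertex has a successor in the counterclockwise order about the origin. -/
lemma exists_next {P V1 V2 : Set (Euc 2)} {r1 r2 ℓ : ℝ} (hP : IsPolytope P)
    (hfull : FullDim P) (h : IsBipartiteWith P V1 V2 r1 r2 ℓ) {v : Euc 2}
    (hv : v ∈ Set.extremePoints ℝ P) :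
    ∃ a, IsEdge P v a ∧ (∀ z ∈ P, 0 ≤ planeDet (a - v) (z - v)) ∧ 0 < planeDet v a := by
  rcases h.2.2.1.symm ▸ hv with hv1 | hv2
  · obtain ⟨w, hvw, hl⟩ := exists_isEdge_forall_planeDet hP hfull hv one_ne_zero
    simp only [one_mul] at hl
    refine ⟨w, hvw, hl, ?_⟩
    obtain ⟨a, b, ha, hal, hpos, hb, -, hneg, -⟩ :=
      h.exists_neighbours_of_mem_V2 hP hfull (h.mem_V2_of_isEdge hv1 hvw)
    have hva : v ≠ a := by
      rintro rfl
      refine not_forall_planeDet_eq_zero hfull (sub_ne_zero.2 hvw.1.symm) v fun z hz =>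
        le_antisymm ?_ (hl z hz)
      have := hal z hz
      simp only [planeDet, PiLp.sub_apply] at this ⊢
      linarith
    have := (h.planeDet_eq_neg ha hvw.symm hva.symm).1
    rw [planeDet_swap]
    linarith
  · obtain ⟨a, b, ha, hal, hpos, -⟩ := h.exists_neighbours_of_mem_V2 hP hfull hv2
    exact ⟨a, ha, hal, hpos⟩

end IsBipartiteWith

/-- A vertex in the cone over a counterclockwise edge is an endpoint of that edge. -/
lemma eq_of_mem_extremePoints_of_eq_add {P : Set (Euc 2)} {p q x y : Euc 2} {α β : ℝ}
    (hp : p ∈ P) (hq : q ∈ P) (hpq : ∀ z ∈ P, 0 ≤ planeDet (q - p) (z - p))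
    (hdet : 0 < planeDet p q) (hx : x ∈ Set.extremePoints ℝ P)
    (hxy : ∀ z ∈ P, 0 ≤ planeDet (y - x) (z - x)) (hdet' : planeDet x y = planeDet p q)
    (hα : 0 < α) (hβ : 0 ≤ β) (hxe : x = α • p + β • q) : x = p := by
  have hle : α + β ≤ 1 := by
    have h1 : 0 ≤ (1 - (α + β)) * planeDet p q := by
      convert hpq x hx.1 using 1
      subst hxe
      simp only [planeDet, PiLp.sub_apply, PiLp.add_apply, PiLp.smul_apply, smul_eq_mul]
      ring
    have := nonneg_of_mul_nonneg_left h1 hdet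
    linarith
  have hge : 1 ≤ α + β := by
    have h1 := add_nonneg (mul_nonneg hα.le (hxy p hp)) (mul_nonneg hβ (hxy q hq))
    have h2 : α * planeDet (y - x) (p - x) + β * planeDet (y - x) (q - x)
        = (α + β - 1) * planeDet x y := by
      subst hxe
      simp only [planeDet, PiLp.sub_apply, PiLp.add_apply, PiLp.smul_apply, smul_eq_mul]
      ring
    rw [h2, hdet'] at h1
    have := nonneg_of_mul_nonneg_left h1 hdet
    linarith
  have hsum : α + β = 1 := le_antisymm hle hge
  rcases hβ.eq_or_lt with h0 | h0
  · have hα1 : α = 1 := by linarith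
    rw [hxe, ← h0, hα1, one_smul, zero_smul, add_zero]
  · exact ((mem_extremePoints.1 hx).2 p hp q hq ⟨α, β, hα, h0, hsum, hxe.symm⟩).1.symm

/-- The plane vector with polar coordinates `(ρ, θ)`. -/
def planePolar (ρ θ : ℝ) : Euc 2 := !₂[ρ * Real.cos θ, ρ * Real.sin θ]

lemma exists_eq_planePolar {x : Euc 2} (hx : x ≠ 0) (θ₀ : ℝ) :
    ∃ ρ > 0, ∃ t ∈ Set.Ico 0 (2 * Real.pi), x = planePolar ρ (θ₀ + t) := by
  let z : ℂ := ⟨x 0, x 1⟩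
  obtain ⟨m, hm, -⟩ := existsUnique_add_zsmul_mem_Ico Real.two_pi_pos (z.arg - θ₀) 0
  have hz : z ≠ 0 := by
    intro h0
    apply hx
    ext i
    fin_cases i
    · exact congrArg Complex.re h0
    · exact congrArg Complex.im h0
  refine ⟨‖z‖, norm_pos_iff.2 hz, z.arg - θ₀ + m • (2 * Real.pi), by simpa using hm, ?_⟩
  have he : θ₀ + (z.arg - θ₀ + m • (2 * Real.pi)) = z.arg + m * (2 * Real.pi) := by
    rw [zsmul_eq_mul]
    ring
  rw [he]
  ext i
  fin_cases i
  · simp [planePolar, z]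
  · simp [planePolar, z]

lemma planePolar_add_two_pi (ρ θ : ℝ) : planePolar ρ (θ + 2 * Real.pi) = planePolar ρ θ := by
  simp [planePolar]

lemma norm_planePolar {ρ : ℝ} (hρ : 0 ≤ ρ) (θ : ℝ) : ‖planePolar ρ θ‖ = ρ := by
  rw [← sq_eq_sq₀ (norm_nonneg _) hρ, ← planeDot_self]
  simp only [planeDot, planePolar, Matrix.cons_val_zero, Matrix.cons_val_one]
  linear_combination ρ ^ 2 * Real.cos_sq_add_sin_sq θ

lemma cos_sub_eq_one_of_planePolar_eq {ρ σ θ φ : ℝ} (hρ : 0 < ρ) (hσ : 0 < σ)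
    (h : planePolar ρ θ = planePolar σ φ) : Real.cos (θ - φ) = 1 := by
  have hn : ρ = σ := by rw [← norm_planePolar hρ.le θ, h, norm_planePolar hσ.le]
  subst hn
  have h0 := congrArg (fun x : Euc 2 => x 0) h
  have h1 := congrArg (fun x : Euc 2 => x 1) h
  simp only [planePolar, Matrix.cons_val_zero, Matrix.cons_val_one, mul_eq_mul_left_iff,
    hρ.ne', or_false] at h0 h1
  rw [Real.cos_sub, h0, h1]
  linear_combination Real.cos_sq_add_sin_sq φ

lemma eq_planePolar_add {ρ θ c R : ℝ} {y : Euc 2} (hρ : 0 < ρ)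
    (hdot : planeDot (planePolar ρ θ) y = R * Real.cos c)
    (hdet : planeDet (planePolar ρ θ) y = R * Real.sin c) : y = planePolar (R / ρ) (θ + c) := by
  have hne : planePolar ρ θ ≠ 0 := by
    rw [← norm_pos_iff, norm_planePolar hρ.le]
    exact hρ
  apply eq_of_planeDot_eq_of_planeDet_eq hne
  · rw [hdot]
    simp only [planeDot, planePolar, Matrix.cons_val_zero, Matrix.cons_val_one, Real.cos_add,
      Real.sin_add]
    field_simp
    linear_combination (-R * Real.cos c) * Real.cos_sq_add_sin_sq θ
  · rw [hdet]
    simp only [planeDet, planePolar, Matrix.cons_val_zero, Matrix.cons_val_one, Real.cos_add,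
      Real.sin_add]
    field_simp
    linear_combination (-R * Real.sin c) * Real.cos_sq_add_sin_sq θ

lemma planePolar_add_eq {ρ ρ' σ θ c t : ℝ} (hρ : 0 < ρ) (hρ' : 0 < ρ') (hc : Real.sin c ≠ 0) :
    planePolar σ (θ + t) = (σ * Real.sin (c - t) / (ρ * Real.sin c)) • planePolar ρ θ
      + (σ * Real.sin t / (ρ' * Real.sin c)) • planePolar ρ' (θ + c) := by
  ext i
  fin_cases i
  · simp only [planePolar, Real.cos_add, Real.sin_sub, Fin.zero_eta, PiLp.add_apply,
      PiLp.smul_apply, Matrix.cons_val_zero, smul_eq_mul]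
    field_simp
    ring
  · simp only [planePolar, Real.sin_add, Real.sin_sub, Fin.mk_one, PiLp.add_apply,
      PiLp.smul_apply, Matrix.cons_val_one, Matrix.cons_val_fin_one, smul_eq_mul]
    field_simp
    ring

/-- A nonempty set of nonzero plane vectors in which consecutive vectors differ by the angle `c`,
with no vector strictly between them, has `2π / c` elements. -/
lemma ncard_mul_eq_two_pi {E : Set (Euc 2)} {c : ℝ} (hc : 0 < c) (hc' : c < 2 * Real.pi)
    (hne : E.Nonempty) (hE : ∀ x ∈ E, x ≠ 0)
    (hnext : ∀ ρ > 0, ∀ θ, planePolar ρ θ ∈ E → ∃ ρ' > 0, planePolar ρ' (θ + c) ∈ E)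
    (hgap : ∀ ρ > 0, ∀ θ, planePolar ρ θ ∈ E → ∀ σ > 0, ∀ t ∈ Set.Ico 0 c,
      planePolar σ (θ + t) ∈ E → planePolar σ (θ + t) = planePolar ρ θ) :
    E.ncard * c = 2 * Real.pi := by
  obtain ⟨x₀, hx₀⟩ := hne
  obtain ⟨ρ₀, hρ₀, t₀, -, hx₀e⟩ := exists_eq_planePolar (hE x₀ hx₀) 0
  rw [zero_add] at hx₀e
  have hex : ∀ j : ℕ, ∃ ρ > 0, planePolar ρ (t₀ + j * c) ∈ E := by
    intro j
    induction j with
    | zero => exact ⟨ρ₀, hρ₀, by simpa [← hx₀e] using hx₀⟩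
    | succ j ih =>
      obtain ⟨ρ, hρ, hmem⟩ := ih
      obtain ⟨ρ', hρ', hmem'⟩ := hnext ρ hρ _ hmem
      refine ⟨ρ', hρ', ?_⟩
      convert hmem' using 2
      push_cast
      ring
  choose r hr hmem using hex
  have hhit : ∀ σ > 0, ∀ t, 0 ≤ t → planePolar σ (t₀ + t) ∈ E →
      planePolar σ (t₀ + t) = planePolar (r ⌊t / c⌋₊) (t₀ + ⌊t / c⌋₊ * c) := by
    intro σ hσ t ht hx
    have h1 : (⌊t / c⌋₊ : ℝ) * c ≤ t := by
      rw [← le_div_iff₀ hc]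
      exact Nat.floor_le (by positivity)
    have h2 : t < (⌊t / c⌋₊ + 1 : ℝ) * c := by
      rw [← div_lt_iff₀ hc]
      exact Nat.lt_floor_add_one _
    have he : t₀ + t = t₀ + ⌊t / c⌋₊ * c + (t - ⌊t / c⌋₊ * c) := by ring
    rw [he] at hx ⊢
    exact hgap _ (hr _) _ (hmem _) σ hσ _ ⟨by linarith, by linarith⟩ hx
  obtain ⟨n, hn⟩ : ∃ n : ℕ, n * c = 2 * Real.pi := by
    refine ⟨⌊2 * Real.pi / c⌋₊, ?_⟩
    have h0 := hhit ρ₀ hρ₀ (2 * Real.pi) Real.two_pi_pos.le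
      (by rwa [planePolar_add_two_pi, ← hx₀e])
    have h1 := cos_sub_eq_one_of_planePolar_eq hρ₀ (hr _) h0
    have h2 : (⌊2 * Real.pi / c⌋₊ : ℝ) * c ≤ 2 * Real.pi := by
      rw [← le_div_iff₀ hc]
      exact Nat.floor_le (by positivity)
    have h3 : 2 * Real.pi < (⌊2 * Real.pi / c⌋₊ + 1 : ℝ) * c := by
      rw [← div_lt_iff₀ hc]
      exact Nat.lt_floor_add_one _
    rw [Real.cos_eq_one_iff_of_lt_of_lt (by linarith) (by linarith)] at h1
    linarith
  have himage : E = (fun j : ℕ => planePolar (r j) (t₀ + j * c)) '' (Finset.range n) := by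
    ext x
    constructor
    · intro hx
      obtain ⟨σ, hσ, t, ht, rfl⟩ := exists_eq_planePolar (hE x hx) t₀
      refine ⟨⌊t / c⌋₊, ?_, (hhit σ hσ t ht.1 hx).symm⟩
      rw [Finset.mem_coe, Finset.mem_range, Nat.floor_lt (by have := ht.1; positivity),
        div_lt_iff₀ hc, hn]
      exact ht.2
    · rintro ⟨j, -, rfl⟩
      exact hmem j
  have hinj : Set.InjOn (fun j : ℕ => planePolar (r j) (t₀ + j * c)) (Finset.range n) := by
    intro i hi j hj hij
    rw [Finset.mem_coe, Finset.mem_range] at hi hj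
    have h1 := cos_sub_eq_one_of_planePolar_eq (hr i) (hr j) hij
    have hi' : (i : ℝ) * c < n * c := by gcongr
    have hj' : (j : ℝ) * c < n * c := by gcongr
    have hi0 : 0 ≤ (i : ℝ) * c := by positivity
    have hj0 : 0 ≤ (j : ℝ) * c := by positivity
    rw [Real.cos_eq_one_iff_of_lt_of_lt (by linarith) (by linarith)] at h1
    have : (i : ℝ) * c = j * c := by linarith
    exact_mod_cast mul_right_cancel₀ hc.ne' this
  rw [himage, hinj.ncard_image, Set.ncard_coe_finset, Finset.card_range, hn]

open InnerProductGeometry in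
lemma planeDet_eq_norm_mul_sin_angle {x y : Euc 2} (h : 0 ≤ planeDet x y) :
    planeDet x y = ‖x‖ * ‖y‖ * Real.sin (angle x y) := by
  have hsin := sin_angle_nonneg x y
  have hcos := cos_angle_mul_norm_mul_norm x y
  rw [← planeDot_eq_inner] at hcos
  have hsq := planeDot_sq_add_planeDet_sq x y
  rw [← sq_eq_sq₀ h (by positivity), mul_pow, Real.sin_sq]
  rw [← hcos] at hsq
  linear_combination hsq

open InnerProductGeometry in
/-- The angle between two vectors that are symmetric about the line spanned by `v`. -/
lemma angle_sub_sub_eq_two_mul {v a b : Euc 2} (hv : v ≠ 0) (hva : v ≠ a)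
    (hdot : planeDot v a = planeDot v b) (hdet : planeDet v b = -planeDet v a)
    (hle : planeDot v a ≤ ‖v‖ ^ 2) : angle (a - v) (b - v) = 2 * angle v (v - a) := by
  have hvpos := norm_pos_iff.2 hv
  have hapos := norm_pos_iff.2 (sub_ne_zero.2 hva)
  have hinner : inner ℝ v (v - a) = ‖v‖ ^ 2 - planeDot v a := by
    rw [inner_sub_right, real_inner_self_eq_norm_sq, planeDot_eq_inner]
  have hle2 : angle v (v - a) ≤ Real.pi / 2 := by
    rw [angle, Real.arccos_le_pi_div_two, hinner]
    exact div_nonneg (by linarith) (by positivity)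
  have h0 := angle_nonneg v (v - a)
  have hnorm : ‖b - v‖ = ‖v - a‖ := by
    rw [← sq_eq_sq₀ (norm_nonneg _) (norm_nonneg _)]
    have h1 := planeDot_sq_add_planeDet_sq v a
    have h2 := planeDot_sq_add_planeDet_sq v b
    have h3 : ‖v‖ ^ 2 * ‖a‖ ^ 2 = ‖v‖ ^ 2 * ‖b‖ ^ 2 := by
      rw [← h1, ← h2, hdet, hdot, neg_sq]
    have h4 := mul_left_cancel₀ (by positivity) h3
    have h5 := planeDot_eq_of_norm_sub v a
    have h6 := planeDot_eq_of_norm_sub v b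
    rw [norm_sub_rev]
    linarith
  refine Real.injOn_cos ⟨angle_nonneg _ _, angle_le_pi _ _⟩ ⟨by linarith, by linarith⟩ ?_
  rw [Real.cos_two_mul, cos_angle, cos_angle, hnorm, norm_sub_rev a v, hinner,
    ← planeDot_eq_inner]
  have h1 : ‖v‖ ^ 2 * planeDot (a - v) (b - v)
      = (‖v‖ ^ 2 - planeDot v a) ^ 2 - planeDet v a ^ 2 := by
    have : planeDot v v * planeDot (a - v) (b - v) = (planeDot v v - planeDot v a) *
        (planeDot v v - planeDot v b) + planeDet v a * planeDet v b := by
      simp only [planeDot, planeDet, PiLp.sub_apply]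
      ring
    rw [← planeDot_self, this, hdet, ← hdot]
    ring
  have h2 : ‖v‖ ^ 2 * ‖v - a‖ ^ 2 = (‖v‖ ^ 2 - planeDot v a) ^ 2 + planeDet v a ^ 2 := by
    rw [← planeDot_self, ← planeDot_self]
    simp only [planeDot, planeDet, PiLp.sub_apply]
    ring
  field_simp
  linarith

namespace IsBipartiteWith

open InnerProductGeometry in
lemma angle_eq_arccos {P V1 V2 : Set (Euc 2)} {r1 r2 ℓ : ℝ}
    (h : IsBipartiteWith P V1 V2 r1 r2 ℓ) {v a : Euc 2} (hva : IsEdge P v a) :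
    angle v a = Real.arccos ((r1 ^ 2 + r2 ^ 2 - ℓ ^ 2) / 2 / (r1 * r2)) := by
  rw [angle, ← planeDot_eq_inner, h.planeDot_eq hva, h.norm_mul_norm hva]

open InnerProductGeometry in
lemma angle_sub_eq_arccos {P V1 V2 : Set (Euc 2)} {r1 r2 ℓ : ℝ}
    (h : IsBipartiteWith P V1 V2 r1 r2 ℓ) {v a : Euc 2} (hva : IsEdge P v a) :
    angle v (v - a) =
      Real.arccos ((‖v‖ ^ 2 - (r1 ^ 2 + r2 ^ 2 - ℓ ^ 2) / 2) / (‖v‖ * ℓ)) := by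
  rw [angle, inner_sub_right, real_inner_self_eq_norm_sq, ← planeDot_eq_inner,
    h.planeDot_eq hva, h.2.1 v a hva]

open InnerProductGeometry in
/-- The interior angle at a vertex is twice the angle between an edge and the direction of the
origin. -/
lemma interior_angle_eq {P V1 V2 : Set (Euc 2)} {r1 r2 ℓ : ℝ} (hP : IsPolytope P)
    (hfull : FullDim P) (h : IsBipartiteWith P V1 V2 r1 r2 ℓ) {v a b : Euc 2}
    (ha : IsEdge P v a) (hb : IsEdge P v b) (hab : a ≠ b) :
    angle (a - v) (b - v) = 2 * angle v (v - a) := by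
  have hvE := h.mem_extremePoints_of_isEdge ha
  have hdot : ∀ {c}, IsEdge P v c → planeDot v c = (r1 ^ 2 + r2 ^ 2 - ℓ ^ 2) / 2 := h.planeDot_eq
  refine angle_sub_sub_eq_two_mul (h.ne_zero hvE) ha.1 ((hdot ha).trans (hdot hb).symm)
    (h.planeDet_eq_neg ha hb hab).1 ?_
  obtain ⟨c, hc, hl, hpos⟩ := h.exists_next hP hfull hvE
  obtain ⟨d, hd, hcd⟩ : ∃ d, IsEdge P v d ∧ c ≠ d := by
    by_cases hca : c = a
    · exact ⟨b, hb, hca ▸ hab⟩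
    · exact ⟨a, ha, hca⟩
  have h1 : 0 ≤ 2 * planeDet v c * (‖v‖ ^ 2 - planeDot v c) := by
    rw [← h.norm_sq_mul_planeDet_sub hc hd hcd]
    exact mul_nonneg (by positivity) (hl d hd.right_mem)
  have h2 := nonneg_of_mul_nonneg_right h1 (by positivity)
  rw [hdot ha, ← hdot hc]
  linarith

open InnerProductGeometry in
/-- The edges of a bipartite polygon subtend equal angles at the origin, which add up to a full
turn. -/
lemma ncard_mul_angle {P V1 V2 : Set (Euc 2)} {r1 r2 ℓ : ℝ} (hP : IsPolytope P)
    (hfull : FullDim P) (h : IsBipartiteWith P V1 V2 r1 r2 ℓ) {v a : Euc 2}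
    (hva : IsEdge P v a) :
    (Set.extremePoints ℝ P).ncard * angle v a = 2 * Real.pi := by
  have hnext : ∀ x ∈ Set.extremePoints ℝ P, ∃ y, IsEdge P x y ∧
      (∀ z ∈ P, 0 ≤ planeDet (y - x) (z - x)) ∧
      planeDot x y = r1 * r2 * Real.cos (angle v a) ∧
      planeDet x y = r1 * r2 * Real.sin (angle v a) ∧ 0 < planeDet x y := by
    intro x hx
    obtain ⟨y, hxy, hl, hpos⟩ := h.exists_next hP hfull hx
    have hangle : angle v a = angle x y := by rw [h.angle_eq_arccos hva, h.angle_eq_arccos hxy]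
    refine ⟨y, hxy, hl, ?_, ?_, hpos⟩
    · rw [hangle, ← h.norm_mul_norm hxy, planeDot_eq_inner, mul_comm,
        cos_angle_mul_norm_mul_norm]
    · rw [hangle, ← h.norm_mul_norm hxy, ← planeDet_eq_norm_mul_sin_angle hpos.le]
  have hvE := h.mem_extremePoints_of_isEdge hva
  have hR : 0 < r1 * r2 := by
    obtain ⟨-, -, -, -, -, h0, hle, -⟩ := h
    exact mul_pos h0 (h0.trans_le hle)
  have hsin : 0 < Real.sin (angle v a) := by
    obtain ⟨y, -, -, -, hdet, hpos⟩ := hnext v hvE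
    rw [hdet] at hpos
    exact pos_of_mul_pos_right hpos hR.le
  have hc0 : 0 < angle v a := by
    refine (angle_nonneg v a).lt_of_ne fun h0 => ?_
    simp [← h0] at hsin
  have hcpi : angle v a ≤ Real.pi := angle_le_pi v a
  refine ncard_mul_eq_two_pi hc0 (by linarith [Real.pi_pos]) ⟨v, hvE⟩ (fun x hx => h.ne_zero hx)
    ?_ ?_
  · intro ρ hρ θ hx
    obtain ⟨y, hxy, -, hdot, hdet, -⟩ := hnext _ hx
    refine ⟨r1 * r2 / ρ, by positivity, ?_⟩
    rw [← eq_planePolar_add hρ hdot hdet]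
    exact h.mem_extremePoints_of_isEdge hxy.symm
  · intro ρ hρ θ hp σ hσ t ht hx
    obtain ⟨q, hpq, hpl, hdot, hdet, hpos⟩ := hnext _ hp
    obtain ⟨y, -, hxl, -, hdet', -⟩ := hnext _ hx
    have hq := eq_planePolar_add hρ hdot hdet
    have hρ' : 0 < r1 * r2 / ρ := by positivity
    have hsin1 : 0 < Real.sin (angle v a - t) :=
      Real.sin_pos_of_pos_of_lt_pi (by linarith [ht.2]) (by
        rcases ht.1.eq_or_lt with h0 | h0
        · refine lt_of_le_of_ne (by linarith) fun h1 => ?_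
          rw [← h0, sub_zero] at h1
          simp [h1] at hsin
        · linarith)
    have hsin2 : 0 ≤ Real.sin t :=
      Real.sin_nonneg_of_nonneg_of_le_pi ht.1 (by linarith [ht.2])
    refine eq_of_mem_extremePoints_of_eq_add hp.1 hpq.right_mem hpl hpos hx hxl
      (hdet'.trans hdet.symm) (α := σ * Real.sin (angle v a - t) / (ρ * Real.sin (angle v a)))
      (β := σ * Real.sin t / (r1 * r2 / ρ * Real.sin (angle v a)))
      (by positivity) (by positivity) ?_
    rw [hq]
    exact planePolar_add_eq hρ hρ' hsin.ne'

end IsBipartiteWith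

open InnerProductGeometry in
/-- Interior angles of a bipartite `2k`-gon: the interior angle `α1` at a
`1`-vertex and the interior angle `α2` at a `2`-vertex satisfy `α1 + α2 = 2(1 - 1/k)π` and
`α2 ≤ (1 - 1/k)π ≤ α1`, with equality (in either place) iff `r1 = r2`. -/
theorem bipartite_polygon_interior_angles
    (P V1 V2 : Set (Euc 2)) (r1 r2 ℓ : ℝ) (k : ℕ) (hk : 2 ≤ k)
    (hP : IsPolytope P) (hfull : FullDim P)
    (hbip : IsBipartiteWith P V1 V2 r1 r2 ℓ)
    (hcard : (Set.extremePoints ℝ P).ncard = 2 * k)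
    (v w1 w2 : Euc 2) (hv : v ∈ V1) (hw : w1 ≠ w2)
    (h1 : IsEdge P v w1) (h2 : IsEdge P v w2)
    (v' w1' w2' : Euc 2) (hv' : v' ∈ V2) (hw' : w1' ≠ w2')
    (h1' : IsEdge P v' w1') (h2' : IsEdge P v' w2') :
    angle (w1 - v) (w2 - v) + angle (w1' - v') (w2' - v')
        = 2 * (1 - 1 / (k : ℝ)) * Real.pi ∧
    angle (w1' - v') (w2' - v') ≤ (1 - 1 / (k : ℝ)) * Real.pi ∧
    (1 - 1 / (k : ℝ)) * Real.pi ≤ angle (w1 - v) (w2 - v) ∧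
    (angle (w1' - v') (w2' - v') = (1 - 1 / (k : ℝ)) * Real.pi ↔ r1 = r2) ∧
    (angle (w1 - v) (w2 - v) = (1 - 1 / (k : ℝ)) * Real.pi ↔ r1 = r2) := by
  have hbip' := hbip
  obtain ⟨hℓ, hlen, -, -, -, hr1, hle, hn1, hn2⟩ := hbip'
  have hr2 : 0 < r2 := hr1.trans_le hle
  have hk0 : (0 : ℝ) < k := by exact_mod_cast (by omega : 0 < k)
  have hc : angle v w1 = Real.pi / k := by
    have := hbip.ncard_mul_angle hP hfull h1
    rw [hcard] at this
    push_cast at this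
    rw [eq_div_iff hk0.ne']
    linarith
  have hw1 := hbip.mem_V2_of_isEdge hv h1
  have hsum := angle_add_angle_sub_add_angle_sub_eq_pi v
    (hbip.ne_zero (hbip.mem_extremePoints_of_isEdge h1.symm))
  have hdot := hbip.planeDot_sq_add_planeDet_sq h1
  have hne := (hbip.planeDet_eq_neg h1 h2 hw).2
  have hκ := hbip.planeDot_eq h1
  rw [hbip.interior_angle_eq hP hfull h1 h2 hw, hbip.interior_angle_eq hP hfull h1' h2' hw']
  rw [hc] at hsum
  have hβ : angle v' (v' - w1') = angle w1 (w1 - v) := by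
    rw [hbip.angle_sub_eq_arccos h1', hbip.angle_sub_eq_arccos h1.symm, hn2 _ hv', hn2 _ hw1]
  rw [hβ]
  have hpi : (1 - 1 / (k : ℝ)) * Real.pi = Real.pi - Real.pi / k := by ring
  rw [mul_assoc, hpi]
  have hα := hbip.angle_sub_eq_arccos h1
  have hβ' := hbip.angle_sub_eq_arccos h1.symm
  rw [hn1 v hv] at hα
  rw [hn2 w1 hw1] at hβ'
  rw [← hκ] at hα hβ'
  have hpos : 0 < r1 * r2 + planeDot v w1 := by
    have := abs_lt_of_sq_lt_sq (a := planeDot v w1) (b := r1 * r2)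
      (by have : 0 < planeDet v w1 ^ 2 := by positivity
          linarith) (by positivity)
    linarith [(abs_lt.1 this).1]
  have hdiff : (r2 ^ 2 - planeDot v w1) / (r2 * ℓ) - (r1 ^ 2 - planeDot v w1) / (r1 * ℓ)
      = (r2 - r1) * ((r1 * r2 + planeDot v w1) / (r1 * r2 * ℓ)) := by
    field_simp
    ring
  have hfac : 0 < (r1 * r2 + planeDot v w1) / (r1 * r2 * ℓ) := by positivity
  have hle' : angle w1 (w1 - v) ≤ angle v (v - w1) := by
    rw [hα, hβ']
    apply Real.arccos_le_arccos
    have := mul_nonneg (sub_nonneg.2 hle) hfac.le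
    linarith
  have hiff : angle w1 (w1 - v) = angle v (v - w1) ↔ r1 = r2 := by
    constructor
    · intro heq
      have hcos := congrArg Real.cos heq
      rw [cos_angle, cos_angle, inner_sub_right, inner_sub_right, real_inner_self_eq_norm_sq,
        real_inner_self_eq_norm_sq, real_inner_comm, ← planeDot_eq_inner, hn1 v hv, hn2 w1 hw1,
        hlen v w1 h1, hlen w1 v h1.symm] at hcos
      rw [hcos, sub_self, eq_comm, mul_eq_zero, or_iff_left hfac.ne', sub_eq_zero] at hdiff
      exact hdiff.symm
    · intro heq
      rw [hα, hβ', heq]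
  refine ⟨by linarith, by linarith, by linarith, ?_, ?_⟩
  · rw [← hiff]
    constructor <;> intro <;> linarith
  · rw [← hiff]
    constructor <;> intro <;> linarith
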